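/- arXiv:1210.5758 — 2 statements merged into one kernel-verified Lean document; each statement's English description precedes it below -/
import Mathlib

section
/- Let U ⊆ ℝ² be open and f : U → ℝ² be a map which is locally an isometry at every point (i.e., every point has a neighborhood on which f preserves distances). If U is connected, then f is an isometry on all of U. -/
open MeasureTheory Metric Set

/-- A distance-preserving map on a ball of a finite-dimensional inner product space is the
restriction of an affine isometry. -/
theorem exists_linearIsometry_of_dist_eq_on_ball {E F : Type*}
    [NormedAddCommGroup E] [InnerProductSpace ℝ E] [FiniteDimensional ℝ E]
    [NormedAddCommGroup F] [InnerProductSpace ℝ F] {f : E → F} {z : E} {r : ℝ} (hr : 0 < r)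
    (hf : ∀ x ∈ ball z r, ∀ y ∈ ball z r, dist (f x) (f y) = dist x y) :
    ∃ L : E →ₗᵢ[ℝ] F, ∀ x ∈ ball z r, f x = f z + L (x - z) := by
  have inner_eq : ∀ x ∈ ball z r, ∀ y ∈ ball z r,
      inner ℝ (f x - f z) (f y - f z) = inner ℝ (x - z) (y - z) := by
    intro x hx y hy
    have hz := mem_ball_self (x := z) hr
    rw [real_inner_eq_norm_mul_self_add_norm_mul_self_sub_norm_sub_mul_self_div_two,
      real_inner_eq_norm_mul_self_add_norm_mul_self_sub_norm_sub_mul_self_div_two,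
      sub_sub_sub_cancel_right, sub_sub_sub_cancel_right]
    simp only [← dist_eq_norm]
    rw [hf x hx z hz, hf y hy z hz, hf x hx y hy]
  let b := stdOrthonormalBasis ℝ E
  have hr2 : r / 2 ≠ 0 := by positivity
  have mem : ∀ i, z + (r / 2) • b i ∈ ball z r := by
    intro i
    rw [mem_ball, dist_eq_norm, add_sub_cancel_left, norm_smul, b.norm_eq_one,
      Real.norm_of_nonneg (by positivity)]
    linarith
  let u : Fin (Module.finrank ℝ E) → F := fun i => (r / 2)⁻¹ • (f (z + (r / 2) • b i) - f z)
  have inner_u : ∀ x ∈ ball z r, ∀ i, inner ℝ (f x - f z) (u i) = inner ℝ (x - z) (b i) := by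
    intro x hx i
    simp only [u]
    rw [real_inner_smul_right, inner_eq x hx _ (mem i), add_sub_cancel_left,
      real_inner_smul_right, inv_mul_cancel_left₀ hr2]
  have hu : Orthonormal ℝ u := by
    rw [orthonormal_iff_ite]
    intro i j
    rw [show u i = (r / 2)⁻¹ • (f (z + (r / 2) • b i) - f z) from rfl, real_inner_smul_left,
      inner_u _ (mem i), add_sub_cancel_left, real_inner_smul_left, inv_mul_cancel_left₀ hr2]
    exact orthonormal_iff_ite.1 b.orthonormal i j
  let L₀ : E →ₗ[ℝ] F := b.toBasis.constr ℝ u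
  have hL₀ : ∀ i, L₀ (b i) = u i := fun i => by
    rw [← b.coe_toBasis]; exact b.toBasis.constr_basis ℝ u i
  let L : E →ₗᵢ[ℝ] F := L₀.isometryOfOrthonormal (v := b.toBasis)
    (by simp)
    (by convert hu using 1; ext i; simpa using hL₀ i)
  have hL : ∀ i, L (b i) = u i := hL₀
  refine ⟨L, fun x hx => ?_⟩
  have hinner : (innerₛₗ ℝ (f x - f z)).comp L.toLinearMap = innerₛₗ ℝ (x - z) := by
    refine b.toBasis.ext fun i => ?_
    simpa [hL, inner_sub_left] using inner_u x hx i
  have hcross : inner ℝ (f x - f z) (L (x - z)) = inner ℝ (x - z) (x - z) :=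
    LinearMap.congr_fun hinner (x - z)
  have hzero : ‖(f x - f z) - L (x - z)‖ ^ 2 = 0 := by
    rw [norm_sub_sq_real, hcross, L.norm_map, real_inner_self_eq_norm_sq, ← dist_eq_norm (f x),
      hf x hx z (mem_ball_self hr), ← dist_eq_norm x]
    ring
  rw [sq_eq_zero_iff, norm_eq_zero, sub_eq_zero] at hzero
  rw [← hzero, add_sub_cancel]

theorem stmt2 (U : Set (EuclideanSpace ℝ (Fin 2))) (hUo : IsOpen U) (hUc : IsConnected U)
    (f : EuclideanSpace ℝ (Fin 2) → EuclideanSpace ℝ (Fin 2))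
    (hloc : ∀ z ∈ U, ∃ V ∈ nhds z, V ⊆ U ∧ ∀ x ∈ V, ∀ y ∈ V, dist (f x) (f y) = dist x y) :
    ∀ x ∈ U, ∀ y ∈ U, dist (f x) (f y) = dist x y := by
  have hlocal : ∀ z ∈ U, ∃ L : EuclideanSpace ℝ (Fin 2) →ₗᵢ[ℝ] EuclideanSpace ℝ (Fin 2),
      f =ᶠ[nhds z] fun x => f z + L (x - z) := by
    intro z hz
    obtain ⟨V, hV, -, hVf⟩ := hloc z hz
    obtain ⟨r, hr, hrV⟩ := Metric.mem_nhds_iff.1 hV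
    obtain ⟨L, hL⟩ := exists_linearIsometry_of_dist_eq_on_ball hr
      fun x hx y hy => hVf x (hrV hx) y (hrV hy)
    exact ⟨L, Filter.eventually_of_mem (ball_mem_nhds z hr) hL⟩
  have hanalytic : ∀ (L : EuclideanSpace ℝ (Fin 2) →ₗᵢ[ℝ] EuclideanSpace ℝ (Fin 2))
      (z w : EuclideanSpace ℝ (Fin 2)), AnalyticAt ℝ (fun x => f z + L (x - z)) w :=
    fun L z w => analyticAt_const.add <|
      (L.toContinuousLinearMap.analyticAt (w - z)).comp_of_eq
        (analyticAt_id.sub analyticAt_const) rfl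
  have hf : AnalyticOnNhd ℝ f U := fun z hz => by
    obtain ⟨L, hL⟩ := hlocal z hz
    exact (hanalytic L z z).congr hL.symm
  obtain ⟨z, hz⟩ := hUc.nonempty
  obtain ⟨L, hL⟩ := hlocal z hz
  have heq := hf.eqOn_of_preconnected_of_eventuallyEq (fun w _ => hanalytic L z w)
    hUc.isPreconnected hz hL
  intro x hx y hy
  rw [heq hx, heq hy, dist_add_left, L.dist_map, dist_sub_right]
end

section
/- Let E ⊆ ℝ² be a bounded measurable set and let (fₙ) be a sequence of contractions fₙ : E → ℝ² such that λ(fₙ(E)) ≥ λ(E) - 1/n. Then, after composing each fₙ with a suitable translation so that the images remain in a fixed bounded set, some subsequence of (fₙ) converges uniformly on E to an isometry of E into ℝ², provided E is a bounded connected open set. -/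
open MeasureTheory Metric Set ENNReal

open Module in
/-- A `1`-Lipschitz map does not increase Haar measure on a finite-dimensional space. -/
theorem LipschitzOnWith.addHaar_image_le {V : Type*} [NormedAddCommGroup V] [NormedSpace ℝ V]
    [FiniteDimensional ℝ V] [MeasurableSpace V] [BorelSpace V] (μ : Measure V)
    [μ.IsAddHaarMeasure] {f : V → V} {s : Set V} (hf : LipschitzOnWith 1 f s) :
    μ (f '' s) ≤ μ s := by
  rw [Measure.isAddLeftInvariant_eq_smul μ (Measure.hausdorffMeasure (finrank ℝ V : ℝ))]
  simp only [Measure.smul_apply]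
  refine smul_le_smul_of_nonneg_left ?_ zero_le
  simpa using hf.hausdorffMeasure_image_le (d := (finrank ℝ V : ℝ)) (by positivity)

open Module in
/-- A distance-preserving map on a ball of a Euclidean space is the restriction of an affine
isometry. -/
theorem exists_linearIsometryEquiv_eqOn_ball {V : Type*} [NormedAddCommGroup V]
    [InnerProductSpace ℝ V] [FiniteDimensional ℝ V] {g : V → V} {p : V} {r : ℝ} (hr : 0 < r)
    (hg : ∀ x ∈ ball p r, ∀ y ∈ ball p r, dist (g x) (g y) = dist x y) :
    ∃ L : V ≃ₗᵢ[ℝ] V, EqOn g (fun x => L (x - p) + g p) (ball p r) := by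
  have hp : p ∈ ball p r := mem_ball_self hr
  have key : ∀ x ∈ ball p r, ∀ y ∈ ball p r,
      inner ℝ (g x - g p) (g y - g p) = inner ℝ (x - p) (y - p) := by
    intro x hx y hy
    rw [real_inner_eq_norm_mul_self_add_norm_mul_self_sub_norm_sub_mul_self_div_two,
      real_inner_eq_norm_mul_self_add_norm_mul_self_sub_norm_sub_mul_self_div_two]
    simp only [sub_sub_sub_cancel_right, ← dist_eq_norm]
    rw [hg x hx p hp, hg y hy p hp, hg x hx y hy]
  let b := stdOrthonormalBasis ℝ V
  set t : ℝ := r / 2 with ht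
  have ht0 : t ≠ 0 := by positivity
  have hb : ∀ i, p + t • b i ∈ ball p r := by
    intro i
    rw [mem_ball, dist_eq_norm, add_sub_cancel_left, norm_smul, b.orthonormal.1 i, mul_one,
      Real.norm_of_nonneg (by positivity)]
    exact half_lt_self hr
  let u := fun i => t⁻¹ • (g (p + t • b i) - g p)
  have hui : ∀ i, ∀ x ∈ ball p r, inner ℝ (u i) (g x - g p) = inner ℝ (b i) (x - p) := by
    intro i x hx
    simp only [u]
    rw [real_inner_smul_left, key _ (hb i) _ hx, add_sub_cancel_left, real_inner_smul_left,
      inv_mul_cancel_left₀ ht0]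
  have hu : Orthonormal ℝ u := by
    rw [orthonormal_iff_ite]
    intro i j
    rw [show u j = t⁻¹ • (g (p + t • b j) - g p) from rfl, real_inner_smul_right,
      hui i _ (hb j), add_sub_cancel_left, real_inner_smul_right, inv_mul_cancel_left₀ ht0]
    exact orthonormal_iff_ite.1 b.orthonormal i j
  let c := OrthonormalBasis.mk hu
    (hu.linearIndependent.span_eq_top_of_card_eq_finrank' (by simp)).ge
  have hc : ∀ i, c i = u i := fun i => by simp [c]
  refine ⟨b.equiv c (Equiv.refl _), fun x hx => ?_⟩
  rw [← sub_eq_iff_eq_add]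
  refine InnerProductSpace.ext_inner_left_basis c.toBasis fun i => ?_
  rw [OrthonormalBasis.coe_toBasis]
  nth_rewrite 2 [show c i = b.equiv c (Equiv.refl _) (b i) by simp]
  rw [LinearIsometryEquiv.inner_map_map, hc, hui i x hx]

open Filter Topology in
/-- A map that is locally distance-preserving on a connected open subset of a Euclidean space
is distance-preserving there. -/
theorem dist_map_eq_of_locally_isometric {V : Type*} [NormedAddCommGroup V]
    [InnerProductSpace ℝ V] [FiniteDimensional ℝ V] {g : V → V} {s : Set V}
    (hs : IsPreconnected s)
    (hg : ∀ p ∈ s, ∃ r > 0, ∀ x ∈ ball p r, ∀ y ∈ ball p r, dist (g x) (g y) = dist x y) :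
    ∀ x ∈ s, ∀ y ∈ s, dist (g x) (g y) = dist x y := by
  have affine : ∀ p ∈ s, ∃ L : V ≃ₗᵢ[ℝ] V, g =ᶠ[𝓝 p] fun x => L (x - p) + g p := by
    intro p hp
    obtain ⟨r, hr, h⟩ := hg p hp
    obtain ⟨L, hL⟩ := exists_linearIsometryEquiv_eqOn_ball hr h
    exact ⟨L, hL.eventuallyEq_of_mem (ball_mem_nhds p hr)⟩
  have analytic : ∀ (L : V ≃ₗᵢ[ℝ] V) (p q x : V),
      AnalyticAt ℝ (fun x => L (x - p) + q) x := by
    intro L p q x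
    exact (((L : V →L[ℝ] V).analyticAt _).comp
      (analyticAt_id.sub analyticAt_const)).add analyticAt_const
  intro x hx y hy
  obtain ⟨L, hL⟩ := affine x hx
  have hgs : AnalyticOnNhd ℝ g s := fun p hp => by
    obtain ⟨M, hM⟩ := affine p hp
    exact (analytic M p (g p) p).congr hM.symm
  have heq := hgs.eqOn_of_preconnected_of_eventuallyEq
    (fun p _ => analytic L x (g x) p) hs hx hL
  rw [heq hx, heq hy, dist_add_right, L.dist_map, dist_sub_right]

open Filter Topology in
/-- Arzelà–Ascoli for pointwise bounded, uniformly Lipschitz sequences on a bounded set. -/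
theorem exists_subseq_tendstoUniformlyOn_of_lipschitzOnWith {X V : Type*} [PseudoMetricSpace X]
    [ProperSpace X] [NormedAddCommGroup V] [NormedSpace ℝ V] [FiniteDimensional ℝ V]
    {s : Set X} (hs : Bornology.IsBounded s) {f : ℕ → X → V} {K : NNReal}
    (hf : ∀ n, LipschitzOnWith K (f n) s) {x₀ : X} (hx₀ : x₀ ∈ s) (h₀ : ∀ n, f n x₀ = 0) :
    ∃ φ : ℕ → ℕ, StrictMono φ ∧ ∃ g : X → V,
      TendstoUniformlyOn (fun k => f (φ k)) g atTop s := by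
  classical
  choose F hFL hFeq using fun n => (hf n).extend_finite_dimension
  have : CompactSpace (closure s) := isCompact_iff_compactSpace.1 hs.isCompact_closure
  set C := lipschitzExtensionConstant V * K
  let G : ℕ → BoundedContinuousFunction (closure s) V := fun n =>
    .mkOfCompact ⟨fun x => F n x, (hFL n).continuous.comp continuous_subtype_val⟩
  have hGa : ∀ n x, G n x = F n x := fun _ _ => rfl
  obtain ⟨R, hR⟩ := (isBounded_iff_subset_closedBall x₀).1 hs.closure
  have hcomp : IsCompact (closure (range G)) := by
    refine BoundedContinuousFunction.arzela_ascoli (closedBall 0 (C * R))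
      (isCompact_closedBall _ _) _ ?_ ?_
    · rintro _ x ⟨n, rfl⟩
      have h := (hFL n).dist_le_mul x x₀
      rw [← hFeq n hx₀, h₀] at h
      rw [hGa, mem_closedBall]
      exact h.trans (by gcongr; exact hR x.2)
    · refine equicontinuous_of_continuity_modulus (fun d => C * d) ?_ _ ?_
      · simpa using (continuous_const_mul (C : ℝ)).tendsto 0
      · rintro x y ⟨_, n, rfl⟩
        exact (hFL n).dist_le_mul x y
  obtain ⟨g, -, φ, hφ, hlim⟩ := hcomp.tendsto_subseq fun n => subset_closure (mem_range_self n)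
  refine ⟨φ, hφ, fun x => if hx : x ∈ closure s then g ⟨x, hx⟩ else 0, ?_⟩
  rw [BoundedContinuousFunction.tendsto_iff_tendstoUniformly] at hlim
  rw [Metric.tendstoUniformly_iff] at hlim
  rw [Metric.tendstoUniformlyOn_iff]
  intro ε hε
  filter_upwards [hlim ε hε] with n hn x hx
  have h := hn ⟨x, subset_closure hx⟩
  rw [Function.comp_apply, hGa, ← hFeq _ hx] at h
  rwa [dif_pos (subset_closure hx)]

/-- If a `1`-Lipschitz map loses at most `ε` of the measure of `s`, then the balls centred at the
images of the centres of two disjoint balls in `s` overlap in measure at most `ε`. -/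
theorem LipschitzOnWith.addHaar_inter_closedBall_le {V : Type*} [NormedAddCommGroup V]
    [NormedSpace ℝ V] [FiniteDimensional ℝ V] [MeasurableSpace V] [BorelSpace V] (μ : Measure V)
    [μ.IsAddHaarMeasure] {f : V → V} {s : Set V} (hf : LipschitzOnWith 1 f s) (hs : μ s ≠ ∞)
    {ε : ℝ≥0∞} (hε : μ s ≤ μ (f '' s) + ε) {x y : V} {r : ℝ} (hr : 0 ≤ r)
    (hx : closedBall x r ⊆ s) (hy : closedBall y r ⊆ s)
    (hxy : Disjoint (closedBall x r) (closedBall y r)) :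
    μ (closedBall (f x) r ∩ closedBall (f y) r) ≤ ε := by
  have maps : ∀ z, closedBall z r ⊆ s → f '' closedBall z r ⊆ closedBall (f z) r := by
    rintro z hz _ ⟨w, hw, rfl⟩
    have h := hf.dist_le_mul w (hz hw) z (hz (mem_closedBall_self hr))
    rw [NNReal.coe_one, one_mul] at h
    exact h.trans hw
  set A := closedBall x r
  set B := closedBall y r
  set A' := closedBall (f x) r
  set B' := closedBall (f y) r
  have hA : μ A' = μ A := Measure.addHaar_closedBall_center μ _ _ |>.trans
    (Measure.addHaar_closedBall_center μ _ _).symm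
  have hB : μ B' = μ B := Measure.addHaar_closedBall_center μ _ _ |>.trans
    (Measure.addHaar_closedBall_center μ _ _).symm
  have hsplit : μ s = μ (A ∪ B) + μ (s \ (A ∪ B)) := by
    rw [← measure_inter_add_sdiff s (measurableSet_closedBall.union measurableSet_closedBall),
      inter_eq_self_of_subset_right (union_subset hx hy)]
  have himage : μ (f '' s) ≤ μ (A' ∪ B') + μ (s \ (A ∪ B)) := by
    calc μ (f '' s) = μ (f '' (A ∪ B) ∪ f '' (s \ (A ∪ B))) := by
          rw [← image_union, union_sdiff_cancel (union_subset hx hy)]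
      _ ≤ μ (f '' (A ∪ B)) + μ (f '' (s \ (A ∪ B))) := measure_union_le _ _
      _ ≤ _ := by
          refine add_le_add (measure_mono ?_) ?_
          · rw [image_union]
            exact union_subset_union (maps x hx) (maps y hy)
          · exact (hf.mono sdiff_subset).addHaar_image_le μ
  have hunion : μ (A ∪ B) ≤ μ (A' ∪ B') + ε := by
    have hfin : μ (s \ (A ∪ B)) ≠ ∞ := measure_ne_top_of_subset sdiff_subset hs
    rw [← ENNReal.add_le_add_iff_right hfin, ← hsplit, add_right_comm]
    exact hε.trans (by gcongr)
  have hfin : μ (A' ∪ B') ≠ ∞ :=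
    (isCompact_closedBall _ _ |>.union (isCompact_closedBall _ _)).measure_lt_top.ne
  rw [← ENNReal.add_le_add_iff_left hfin, measure_union_add_inter _ measurableSet_closedBall,
    hA, hB, ← measure_union hxy measurableSet_closedBall]
  exact hunion

open Filter Topology in
/-- A pointwise limit of `1`-Lipschitz maps which asymptotically preserve the measure of `s` does
not shrink the distance between the centres of disjoint balls of equal radius in `s`. -/
theorem two_mul_le_dist_of_tendsto {V : Type*} [NormedAddCommGroup V]
    [NormedSpace ℝ V] [FiniteDimensional ℝ V] [MeasurableSpace V] [BorelSpace V] (μ : Measure V)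
    [μ.IsAddHaarMeasure] {f : ℕ → V → V} {g : V → V} {s : Set V}
    (hf : ∀ n, LipschitzOnWith 1 (f n) s) (hs : μ s ≠ ∞) {ε : ℕ → ℝ≥0∞}
    (hε : ∀ᶠ n in atTop, μ s ≤ μ (f n '' s) + ε n) (hε0 : Tendsto ε atTop (𝓝 0))
    (hlim : ∀ x ∈ s, Tendsto (fun n => f n x) atTop (𝓝 (g x)))
    {x y : V} {r : ℝ} (hr : 0 ≤ r) (hx : closedBall x r ⊆ s) (hy : closedBall y r ⊆ s)
    (hxy : Disjoint (closedBall x r) (closedBall y r)) :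
    2 * r ≤ dist (g x) (g y) := by
  by_contra! hlt
  have hd : Tendsto (fun n => dist (f n x) (f n y)) atTop (𝓝 (dist (g x) (g y))) :=
    (hlim x (hx (mem_closedBall_self hr))).dist (hlim y (hy (mem_closedBall_self hr)))
  obtain ⟨d, hd₁, hd₂⟩ := exists_between hlt
  have hδ : 0 < r - d / 2 := by linarith
  have hpos : 0 < μ (closedBall 0 (r - d / 2)) := measure_closedBall_pos μ _ hδ
  obtain ⟨n, hn₁, hn₂, hn₃⟩ :=
    ((hd.eventually_lt_const hd₁).and (hε.and (hε0.eventually_lt_const hpos))).exists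
  have hle := (hf n).addHaar_inter_closedBall_le μ hs hn₂ hr hx hy hxy
  refine absurd (hle.trans_lt hn₃) (not_lt.2 ?_)
  rw [← Measure.addHaar_closedBall_center μ (midpoint ℝ (f n x) (f n y))]
  refine measure_mono (subset_inter ?_ ?_)
  · refine closedBall_subset_closedBall' ?_
    rw [dist_midpoint_left, Real.norm_of_nonneg (by norm_num)]
    linarith
  · refine closedBall_subset_closedBall' ?_
    rw [dist_midpoint_right, Real.norm_of_nonneg (by norm_num)]
    linarith

open Filter Topology in
/-- On a connected open set of finite measure, a pointwise limit of `1`-Lipschitz maps which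
asymptotically preserve the measure of the set is distance-preserving. -/
theorem dist_map_eq_of_tendsto_of_measure_le {V : Type*} [NormedAddCommGroup V]
    [InnerProductSpace ℝ V] [FiniteDimensional ℝ V] [MeasurableSpace V] [BorelSpace V]
    (μ : Measure V) [μ.IsAddHaarMeasure] {f : ℕ → V → V} {g : V → V} {s : Set V}
    (hs : IsPreconnected s) (hso : IsOpen s) (hμ : μ s ≠ ∞)
    (hf : ∀ n, LipschitzOnWith 1 (f n) s) {ε : ℕ → ℝ≥0∞}
    (hε : ∀ᶠ n in atTop, μ s ≤ μ (f n '' s) + ε n) (hε0 : Tendsto ε atTop (𝓝 0))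
    (hlim : ∀ x ∈ s, Tendsto (fun n => f n x) atTop (𝓝 (g x))) :
    ∀ x ∈ s, ∀ y ∈ s, dist (g x) (g y) = dist x y := by
  refine dist_map_eq_of_locally_isometric hs fun p hp => ?_
  obtain ⟨R, hR, hRs⟩ := Metric.isOpen_iff.1 hso p hp
  refine ⟨R / 2, by positivity, fun x hx y hy => le_antisymm ?_ ?_⟩
  · have hxs := hRs (ball_subset_ball (by linarith) hx)
    have hys := hRs (ball_subset_ball (by linarith) hy)
    refine le_of_tendsto ((hlim x hxs).dist (hlim y hys)) (.of_forall fun n => ?_)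
    simpa using (hf n).dist_le_mul x hxs y hys
  · refine le_of_forall_lt_imp_le_of_dense fun d hd => ?_
    rcases lt_or_ge d 0 with h0 | h0
    · exact h0.le.trans dist_nonneg
    rw [mem_ball] at hx hy
    have hxy := dist_triangle_right x y p
    have hball : ∀ z, dist z p < R / 2 → closedBall z (d / 2) ⊆ s := fun z hz =>
      (closedBall_subset_ball' (by linarith)).trans hRs
    have h := two_mul_le_dist_of_tendsto μ hf hμ hε hε0 hlim (r := d / 2) (by positivity)
      (hball x hx) (hball y hy) (closedBall_disjoint_closedBall (by linarith))
    linarith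

theorem stmt17 (E : Set (EuclideanSpace ℝ (Fin 2))) (hEb : Bornology.IsBounded E)
    (hEc : IsConnected E) (hEo : IsOpen E)
    (fs : ℕ → EuclideanSpace ℝ (Fin 2) → EuclideanSpace ℝ (Fin 2))
    (hcontr : ∀ n, ∃ c : ℝ, c < 1 ∧ ∀ x ∈ E, ∀ y ∈ E, dist (fs n x) (fs n y) ≤ c * dist x y)
    (hmeas : ∀ n : ℕ, 1 ≤ n → volume (fs n '' E) ≥ volume E - 1 / (n : ℝ≥0∞)) :
    ∃ v : ℕ → EuclideanSpace ℝ (Fin 2),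
      Bornology.IsBounded (⋃ n, (fun x => fs n x + v n) '' E) ∧
      ∃ φ : ℕ → ℕ, StrictMono φ ∧
        ∃ g : EuclideanSpace ℝ (Fin 2) → EuclideanSpace ℝ (Fin 2),
          TendstoUniformlyOn (fun k x => fs (φ k) x + v (φ k)) g Filter.atTop E ∧
          ∀ x ∈ E, ∀ y ∈ E, dist (g x) (g y) = dist x y := by
  obtain ⟨x₀, hx₀⟩ := hEc.nonempty
  have hlip : ∀ n, LipschitzOnWith 1 (fun x => fs n x + -fs n x₀) E := fun n => by
    obtain ⟨c, hc, h⟩ := hcontr n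
    refine LipschitzOnWith.of_dist_le_mul fun x hx y hy => ?_
    rw [dist_add_right, NNReal.coe_one]
    exact (h x hx y hy).trans (by gcongr)
  have himage : ∀ n, volume ((fun x => fs n x + -fs n x₀) '' E) = volume (fs n '' E) := fun n => by
    rw [← image_image (fun z => z + -fs n x₀) (fs n), image_add_right, measure_preimage_add_right]
  obtain ⟨φ, hφ, g, hg⟩ := exists_subseq_tendstoUniformlyOn_of_lipschitzOnWith hEb hlip hx₀
    fun n => add_neg_cancel _
  refine ⟨fun n => -fs n x₀, ?_, φ, hφ, g, hg, ?_⟩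
  · obtain ⟨R, hR⟩ := (isBounded_iff_subset_closedBall x₀).1 hEb
    refine (isBounded_closedBall (x := 0) (r := R)).subset (iUnion_subset fun n => ?_)
    rintro _ ⟨x, hx, rfl⟩
    have h := (hlip n).dist_le_mul x hx x₀ hx₀
    rw [add_neg_cancel, NNReal.coe_one, one_mul] at h
    exact h.trans (hR hx)
  · refine dist_map_eq_of_tendsto_of_measure_le volume hEc.isPreconnected hEo
      hEb.measure_lt_top.ne (fun n => hlip (φ n)) (ε := fun n => 1 / (φ n : ℝ≥0∞)) ?_ ?_
      fun x hx => hg.tendsto_at hx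
    · filter_upwards [Filter.eventually_ge_atTop 1] with n hn
      rw [himage]
      exact tsub_le_iff_right.1 (hmeas (φ n) (hn.trans (hφ.id_le n)))
    · simpa only [one_div, Function.comp_def] using ENNReal.tendsto_inv_nat_nhds_zero.comp hφ.tendsto_atTop
end
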